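/- There exists a constant L > 0 such that for all α > 0, all r with 0 < r ≤ α, and all ρ with 0 < ρ ≤ r/2, one has μ(B(−r e₂, r) ∩ B((α−ρ)e₂, α)) ≤ L·r^{1/2}·ρ^{3/2}. (One may take L = 8√2/3.) -/

import Mathlib

open MeasureTheory Metric Set
open scoped RealInnerProductSpace ENNReal

noncomputable section

/-- The Euclidean plane. -/
abbrev E2 := EuclideanSpace ℝ (Fin 2)

/-- The point `(a, b)` of the Euclidean plane. -/
def pt (a b : ℝ) : E2 := (WithLp.equiv 2 (Fin 2 → ℝ)).symm ![a, b]

/-- The unit vector `e₂ = (0, 1)`. -/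
def e₂ : E2 := pt 0 1

/-- `𝒞(h) = {x : −h ≤ ⟪x, e₂⟫ ≤ 0} ∩ B(−r e₂, r)`. -/
def Cset (h r : ℝ) : Set E2 :=
  {x : E2 | -h ≤ ⟪x, e₂⟫ ∧ ⟪x, e₂⟫ ≤ 0} ∩ closedBall (-(r • e₂)) r

theorem statement18 :
    ∃ L > (0 : ℝ), ∀ α r ρ : ℝ, 0 < α → 0 < r → r ≤ α → 0 < ρ → ρ ≤ r / 2 →
      volume (closedBall (-(r • e₂)) r ∩ closedBall ((α - ρ) • e₂) α)
        ≤ ENNReal.ofReal (L * r ^ ((1 : ℝ) / 2) * ρ ^ ((3 : ℝ) / 2)) := by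
  refine ⟨2 * √2, by positivity, ?_⟩
  intro α r ρ hα hr hrα hρ hρr
  set s : ℝ := √(2 * r * ρ) with hs
  have hsub : closedBall (-(r • e₂)) r ∩ closedBall ((α - ρ) • e₂) α ⊆
      (WithLp.ofLp : E2 → (Fin 2 → ℝ)) ⁻¹' (Set.Icc ![-s, -ρ] ![s, 0]) := by
    rintro x ⟨h1, h2⟩
    rw [mem_closedBall, EuclideanSpace.dist_eq, Real.sqrt_le_left (by positivity)] at h1 h2
    simp [e₂, pt, Fin.sum_univ_two, Real.dist_eq, sq_abs] at h1 h2
    have hy0 : x 1 ≤ 0 := by nlinarith [sq_nonneg (x 0), sq_nonneg (x 1)]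
    have hy1 : -ρ ≤ x 1 := by
      have : |x 1 - (α - ρ)| ≤ α := abs_le_of_sq_le_sq (by nlinarith [sq_nonneg (x 0)]) hα.le
      linarith [(abs_le.mp this).1]
    have hx : |x 0| ≤ s := Real.abs_le_sqrt (by nlinarith [sq_nonneg (x 1)])
    have hx' := abs_le.mp hx
    simp only [mem_preimage, Set.mem_Icc, Pi.le_def, Fin.forall_fin_two]
    simp
    exact ⟨⟨hx'.1, hy1⟩, hx'.2, hy0⟩
  refine (measure_mono hsub).trans ?_
  rw [(PiLp.volume_preserving_ofLp (Fin 2)).measure_preimage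
    measurableSet_Icc.nullMeasurableSet, Real.volume_Icc_pi]
  simp only [Fin.prod_univ_two]
  rw [← ENNReal.ofReal_mul (by simp; positivity)]
  apply ENNReal.ofReal_le_ofReal
  have e1 : s = √2 * r ^ ((1 : ℝ) / 2) * ρ ^ ((1 : ℝ) / 2) := by
    rw [hs, Real.sqrt_mul (by positivity), Real.sqrt_mul (by positivity), Real.sqrt_eq_rpow r,
      Real.sqrt_eq_rpow ρ]
  have e2 : ρ ^ ((3 : ℝ) / 2) = ρ ^ ((1 : ℝ) / 2) * ρ := by
    rw [← Real.rpow_add_one hρ.ne']; norm_num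
  simp
  rw [e1, e2]
  apply le_of_eq
  norm_num
  ring
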